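/- Let (Z_k)_{k∈ℕ} be a strictly stationary and ergodic process with values in a separable metrizable topological space 𝒵 and marginal distribution θ = L(Z₁). Let h : 𝒵^d → ℝ be measurable and continuous θ^d-almost everywhere, and suppose there is a θ-integrable function f : 𝒵 → ℝ such that |h(z₁, ..., z_d)| ≤ ∏_{k=1}^d f(z_k) for all z₁, ..., z_d ∈ 𝒵. Then the V-statistic V_h(Z₁, ..., Zₙ) converges almost surely to ∫ h dθ^d as n → ∞. -/

import Mathlib

open MeasureTheory Filter Topology

noncomputable section

/-- The shift map on path space. -/
def shift {𝒵 : Type*} (x : ℕ → 𝒵) : ℕ → 𝒵 := fun i => x (i + 1)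

/-- running maximum of Birkhoff sums -/
def maxSum {X : Type*} (T : X → X) (g : X → ℝ) : ℕ → X → ℝ
  | 0 => fun _ => 0
  | n + 1 => fun x => max 0 (g x + maxSum T g n (T x))

lemma maxSum_nonneg {X : Type*} (T : X → X) (g : X → ℝ) (n : ℕ) (x : X) :
    0 ≤ maxSum T g n x := by
  cases n with
  | zero => simp [maxSum]
  | succ n => simp [maxSum]

lemma maxSum_mono {X : Type*} (T : X → X) (g : X → ℝ) (x : X) :
    Monotone (fun n => maxSum T g n x) := by
  refine monotone_nat_of_le_succ fun n => ?_
  induction n generalizing x with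
  | zero => exact maxSum_nonneg T g 1 x
  | succ n ih =>
    have := ih (T x)
    simp only [maxSum] at this ⊢
    gcongr

lemma birkhoffSum_le_maxSum {X : Type*} (T : X → X) (g : X → ℝ) (n : ℕ) (x : X) :
    birkhoffSum T g n x ≤ maxSum T g n x := by
  induction n generalizing x with
  | zero => simp [maxSum]
  | succ n ih =>
    rw [birkhoffSum_succ']
    exact le_max_of_le_right (by linarith [ih (T x)])

section
variable {X : Type*} [MeasurableSpace X] {μ : Measure X} [IsProbabilityMeasure μ] {T : X → X}
  {g : X → ℝ}

lemma maxSum_measurable (hT : Measurable T) (hgm : Measurable g) (n : ℕ) :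
    Measurable (maxSum T g n) := by
  induction n with
  | zero => exact measurable_const
  | succ n ih => exact measurable_const.max (hgm.add (ih.comp hT))

lemma maxSum_integrable (hT : MeasurePreserving T μ μ) (hg : Integrable g μ) (n : ℕ) :
    Integrable (maxSum T g n) μ := by
  induction n with
  | zero => exact integrable_const _
  | succ n ih => exact (integrable_const _).sup (hg.add (hT.integrable_comp_of_integrable ih))

lemma bddAbove_maxSum (hT : Ergodic T μ) (hg : Integrable g μ) (hgm : Measurable g)
    (hneg : ∫ x, g x ∂μ < 0) : ∀ᵐ x ∂μ, BddAbove (Set.range fun n => maxSum T g n x) := by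
  have hTp := hT.toMeasurePreserving
  set A : Set X := {x | BddAbove (Set.range fun n => maxSum T g n x)} with hA
  have hAm : MeasurableSet A :=
    measurableSet_bddAbove_range fun n => maxSum_measurable hTp.measurable hgm n
  have hinv : T ⁻¹' A = A := by
    ext x
    simp only [hA, Set.mem_preimage, Set.mem_ofPred_eq]
    constructor
    · rintro ⟨C, hC⟩
      refine ⟨max 0 (g x + C), ?_⟩
      rintro _ ⟨n, rfl⟩
      cases n with
      | zero => simp [maxSum]
      | succ n =>
        have := hC ⟨n, rfl⟩
        simp only [maxSum] at this ⊢
        gcongr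
    · rintro ⟨C, hC⟩
      refine ⟨C - g x, ?_⟩
      rintro _ ⟨n, rfl⟩
      have h1 := hC ⟨n + 1, rfl⟩
      simp only [maxSum] at h1
      have := (le_max_right _ _).trans h1
      simp only
      linarith
  rcases hT.toPreErgodic.ae_mem_or_ae_notMem hAm hinv with h | h
  · exact h
  exfalso
  have hlim : Tendsto (fun n => ∫ x, (maxSum T g (n + 1) x - maxSum T g n (T x)) ∂μ) atTop
      (𝓝 (∫ x, g x ∂μ)) := by
    refine tendsto_integral_of_dominated_convergence (fun x => |g x|) ?_ hg.abs ?_ ?_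
    · intro n
      exact ((maxSum_measurable hTp.measurable hgm (n + 1)).sub
        ((maxSum_measurable hTp.measurable hgm n).comp hTp.measurable)).aestronglyMeasurable
    · intro n
      refine Eventually.of_forall fun x => ?_
      have h0 := maxSum_nonneg T g n (T x)
      simp only [maxSum, Real.norm_eq_abs]
      rcases le_total 0 (g x + maxSum T g n (T x)) with h1 | h1
      · rw [max_eq_right h1]; simp
      · rw [max_eq_left h1, abs_of_nonpos (by linarith), abs_of_nonpos (by linarith)]
        linarith
    · filter_upwards [h] with x hx
      have hx' : ¬ BddAbove (Set.range fun n => maxSum T g n (T x)) := by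
        intro hh
        apply hx
        rw [← hinv]
        exact hh
      have ht := tendsto_atTop_atTop_of_monotone' (maxSum_mono T g (T x)) hx'
      refine tendsto_const_nhds.congr' ?_
      filter_upwards [ht.eventually_ge_atTop (- g x)] with n hn
      simp only [maxSum]
      rw [max_eq_right (by linarith)]
      ring
  have hnn : ∀ n, 0 ≤ ∫ x, (maxSum T g (n + 1) x - maxSum T g n (T x)) ∂μ := by
    intro n
    have e : ∫ x, maxSum T g n (T x) ∂μ = ∫ x, maxSum T g n x ∂μ := by
      conv_rhs => rw [← hTp.map_eq]
      rw [integral_map hTp.measurable.aemeasurable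
        (maxSum_measurable hTp.measurable hgm n).aestronglyMeasurable]
    have hi : Integrable (fun x => maxSum T g n (T x)) μ :=
      hTp.integrable_comp_of_integrable (maxSum_integrable hTp hg n)
    rw [integral_sub (maxSum_integrable hTp hg _) hi, e, sub_nonneg]
    exact integral_mono (maxSum_integrable hTp hg _) (maxSum_integrable hTp hg _)
      fun x => maxSum_mono T g x (Nat.le_succ n)
  exact absurd (ge_of_tendsto' hlim hnn) (not_le.2 hneg)

lemma birkhoff_upper (hT : Ergodic T μ) (hg : Integrable g μ) (hgm : Measurable g) :
    ∀ᵐ x ∂μ, ∀ ε > 0, ∀ᶠ n : ℕ in atTop, (n : ℝ)⁻¹ * birkhoffSum T g n x < ∫ x, g x ∂μ + ε := by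
  set m := ∫ x, g x ∂μ with hm
  have key : ∀ k : ℕ, ∀ᵐ x ∂μ, BddAbove (Set.range fun n =>
      maxSum T (fun x => g x - (m + 1 / ((k : ℝ) + 1))) n x) := by
    intro k
    refine bddAbove_maxSum hT (hg.sub (integrable_const _)) (hgm.sub measurable_const) ?_
    rw [integral_sub hg (integrable_const _)]
    simp only [integral_const, probReal_univ, one_smul, ← hm]
    have : (0 : ℝ) < 1 / ((k : ℝ) + 1) := by positivity
    linarith
  filter_upwards [ae_all_iff.2 key] with x hx ε hε
  obtain ⟨k, hk⟩ := exists_nat_one_div_lt (half_pos hε)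
  obtain ⟨C, hC⟩ := hx k
  have hCn : Tendsto (fun n : ℕ => C / (n : ℝ)) atTop (𝓝 0) := tendsto_const_div_atTop_nhds_zero_nat C
  filter_upwards [hCn.eventually_lt_const (half_pos hε), eventually_gt_atTop 0] with n hn hn0
  have h1 : birkhoffSum T (fun x => g x - (m + 1 / ((k : ℝ) + 1))) n x ≤ C :=
    (birkhoffSum_le_maxSum _ _ _ _).trans (hC ⟨n, rfl⟩)
  have h2 : birkhoffSum T (fun x => g x - (m + 1 / ((k : ℝ) + 1))) n x
      = birkhoffSum T g n x - n * (m + 1 / ((k : ℝ) + 1)) := by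
    simp [birkhoffSum, Finset.sum_sub_distrib, mul_add]
  rw [h2] at h1
  have hnpos : (0 : ℝ) < n := by exact_mod_cast hn0
  have h3 : (n : ℝ)⁻¹ * birkhoffSum T g n x ≤ C / n + (m + 1 / ((k : ℝ) + 1)) := by
    rw [inv_mul_le_iff₀ hnpos, mul_add, mul_div_cancel₀ _ hnpos.ne']
    linarith
  linarith

lemma birkhoff_tendsto (hT : Ergodic T μ) (hg : Integrable g μ) (hgm : Measurable g) :
    ∀ᵐ x ∂μ, Tendsto (fun n : ℕ => (n : ℝ)⁻¹ * birkhoffSum T g n x) atTop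
      (𝓝 (∫ x, g x ∂μ)) := by
  filter_upwards [birkhoff_upper hT hg hgm, birkhoff_upper hT hg.neg hgm.neg] with x h1 h2
  rw [tendsto_order]
  constructor
  · intro a ha
    filter_upwards [h2 (∫ x, g x ∂μ - a) (by linarith)] with n hn
    rw [birkhoffSum_neg] at hn
    simp only [Pi.neg_apply, integral_neg] at hn
    linarith
  · intro a ha
    filter_upwards [h1 (a - ∫ x, g x ∂μ) (by linarith)] with n hn
    linarith

end


lemma shift_iterate {𝒵 : Type*} (x : ℕ → 𝒵) (n : ℕ) : shift^[n] x = fun i => x (i + n) := by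
  induction n generalizing x with
  | zero => rfl
  | succ n ih =>
    rw [Function.iterate_succ_apply, ih]
    ext i
    simp only [shift]
    congr 1

lemma slln {Ω : Type*} [MeasurableSpace Ω] (P : Measure Ω) [IsProbabilityMeasure P]
    {𝒵 : Type*} [MeasurableSpace 𝒵]
    (Z : ℕ → Ω → 𝒵) (hZmeas : ∀ i, Measurable (Z i))
    (herg : Ergodic shift (P.map fun ω i => Z i ω))
    (θ : Measure 𝒵) (hθ : θ = P.map (Z 0)) (φ : 𝒵 → ℝ) (hφ : Integrable φ θ) :
    ∀ᵐ ω ∂P, Tendsto (fun n : ℕ => (n : ℝ)⁻¹ * ∑ i ∈ Finset.range n, φ (Z i ω)) atTop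
      (𝓝 (∫ z, φ z ∂θ)) := by
  have hpm : Measurable (fun ω i => Z i ω) := measurable_pi_lambda _ hZmeas
  set μ := P.map fun ω i => Z i ω with hμ
  have : IsProbabilityMeasure μ := Measure.isProbabilityMeasure_map hpm.aemeasurable
  have hev : ∀ n, MeasurePreserving (fun x : ℕ → 𝒵 => x n) μ θ := by
    have h0 : MeasurePreserving (fun x : ℕ → 𝒵 => x 0) μ θ := by
      refine ⟨measurable_pi_apply 0, ?_⟩
      rw [hμ, Measure.map_map (measurable_pi_apply 0) hpm, hθ]
      rfl
    intro n
    have := h0.comp (herg.toMeasurePreserving.iterate n)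
    convert this using 1
    ext x
    simp [shift_iterate]
  set ψ := hφ.1.mk φ
  have hψ : φ =ᵐ[θ] ψ := hφ.1.ae_eq_mk
  have hψm : Measurable ψ := hφ.1.stronglyMeasurable_mk.measurable
  have hψi : Integrable ψ θ := hφ.congr hψ
  have hB := birkhoff_tendsto herg ((hev 0).integrable_comp_of_integrable hψi)
    (hψm.comp (measurable_pi_apply 0))
  have hE : ∀ᵐ x ∂μ, ∀ n, φ (x n) = ψ (x n) :=
    ae_all_iff.2 fun n => (hev n).quasiMeasurePreserving.ae hψ
  have hI : ∫ x, (ψ ∘ fun x : ℕ → 𝒵 => x 0) x ∂μ = ∫ z, φ z ∂θ := by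
    rw [integral_congr_ae hψ, ← (hev 0).map_eq,
      integral_map (hev 0).measurable.aemeasurable hψm.aestronglyMeasurable]
    rfl
  rw [hI] at hB
  have := ae_of_ae_map hpm.aemeasurable (hB.and hE)
  filter_upwards [this] with ω hω
  refine hω.1.congr fun n => ?_
  simp only [birkhoffSum, shift_iterate, Function.comp, zero_add]
  congr 1
  exact Finset.sum_congr rfl fun i _ => (hω.2 i).symm

section weak
open ProbabilityTheory

/-- Mapping theorem. -/
lemma map_tendsto {X : Type*} [TopologicalSpace X] [MeasurableSpace X] [OpensMeasurableSpace X]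
    [HasOuterApproxClosed X] {μs : ℕ → ProbabilityMeasure X} {μ : ProbabilityMeasure X}
    (hlim : Tendsto μs atTop (𝓝 μ)) {h : X → ℝ} (hm : Measurable h)
    (hc : ∀ᵐ x ∂(μ : Measure X), ContinuousAt h x) :
    Tendsto (fun n => (μs n).map hm.aemeasurable) atTop (𝓝 (μ.map hm.aemeasurable)) := by
  refine tendsto_of_forall_isClosed_limsup_le' fun F hF => ?_
  have e : ∀ ν : ProbabilityMeasure X,
      ((ν.map hm.aemeasurable : ProbabilityMeasure ℝ) : Measure ℝ) F = (ν : Measure X) (h ⁻¹' F) := by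
    intro ν
    exact Measure.map_apply hm hF.measurableSet
  simp only [e]
  calc limsup (fun n => (μs n : Measure X) (h ⁻¹' F)) atTop
      ≤ limsup (fun n => (μs n : Measure X) (closure (h ⁻¹' F))) atTop :=
        limsup_le_limsup (Eventually.of_forall fun n => measure_mono subset_closure)
    _ ≤ (μ : Measure X) (closure (h ⁻¹' F)) :=
        ProbabilityMeasure.limsup_measure_closed_le_of_tendsto hlim isClosed_closure
    _ ≤ (μ : Measure X) (h ⁻¹' F) := by
        refine measure_mono_ae ?_
        filter_upwards [hc] with x hx hxF
        have : h x ∈ closure (h '' (h ⁻¹' F)) := mem_closure_image hx hxF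
        exact (closure_minimal (Set.image_preimage_subset _ _) hF) this

/-- The empirical measure of the first `n + 1` observations. -/
def emp {𝒵 : Type*} [MeasurableSpace 𝒵] (z : ℕ → 𝒵) (n : ℕ) : ProbabilityMeasure 𝒵 :=
  ⟨(uniformOn (Set.univ : Set (Fin (n + 1)))).map (fun i : Fin (n + 1) => z i),
    haveI : IsProbabilityMeasure (uniformOn (Set.univ : Set (Fin (n + 1)))) :=
      isProbabilityMeasure_uniformOn Set.finite_univ Set.univ_nonempty
    Measure.isProbabilityMeasure_map (Measurable.of_discrete).aemeasurable⟩

lemma uniformOn_singleton_fin (n : ℕ) (i : Fin (n + 1)) :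
    uniformOn (Set.univ : Set (Fin (n + 1))) {i} = ((n : ENNReal) + 1)⁻¹ := by
  rw [uniformOn_univ]
  simp

lemma integral_emp_pi {𝒵 : Type*} [MeasurableSpace 𝒵] (z : ℕ → 𝒵) (n d : ℕ)
    (h : (Fin d → 𝒵) → ℝ) (hm : Measurable h) :
    ∫ x, h x ∂(Measure.pi fun _ : Fin d => (emp z n : Measure 𝒵)) =
      (((n + 1 : ℕ) : ℝ) ^ d)⁻¹ * ∑ i : Fin d → Fin (n + 1), h (fun j => z (i j)) := by
  have : IsProbabilityMeasure (uniformOn (Set.univ : Set (Fin (n + 1)))) :=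
      isProbabilityMeasure_uniformOn Set.finite_univ Set.univ_nonempty
  have e : (Measure.pi fun _ : Fin d => (emp z n : Measure 𝒵)) =
      (Measure.pi fun _ : Fin d => uniformOn (Set.univ : Set (Fin (n + 1)))).map
        (fun i j => z (i j)) := by
    have hP : ∀ _ : Fin d, IsProbabilityMeasure
      ((uniformOn (Set.univ : Set (Fin (n + 1)))).map (fun i : Fin (n + 1) => z i)) := fun _ =>
        Measure.isProbabilityMeasure_map (Measurable.of_discrete).aemeasurable
    exact (Measure.pi_map_pi (f := fun (_ : Fin d) (i : Fin (n + 1)) => z i) (fun _ => (Measurable.of_discrete).aemeasurable)).symm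
  rw [e, integral_map (Measurable.of_discrete).aemeasurable hm.aestronglyMeasurable,
    integral_fintype Integrable.of_finite, Finset.mul_sum]
  refine Finset.sum_congr rfl fun i _ => ?_
  rw [measureReal_def, Measure.pi_singleton]
  have e2 : ((n : ENNReal) + 1).toReal = (n : ℝ) + 1 := by norm_cast
  simp [uniformOn_singleton_fin, smul_eq_mul, e2]

lemma emp_apply {𝒵 : Type*} [MeasurableSpace 𝒵] (z : ℕ → 𝒵) (n : ℕ) {s : Set 𝒵}
    (hs : MeasurableSet s) : ((emp z n s : NNReal) : ℝ) =
      ((n + 1 : ℕ) : ℝ)⁻¹ * ∑ i ∈ Finset.range (n + 1), s.indicator (fun _ => (1 : ℝ)) (z i) := by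
  have : IsProbabilityMeasure (uniformOn (Set.univ : Set (Fin (n + 1)))) :=
      isProbabilityMeasure_uniformOn Set.finite_univ Set.univ_nonempty
  have : ((emp z n s : NNReal) : ℝ) = (emp z n : Measure 𝒵).real s := rfl
  rw [this, ← integral_indicator_one hs]
  change ∫ a, s.indicator 1 a ∂((uniformOn (Set.univ : Set (Fin (n + 1)))).map (fun i : Fin (n + 1) => z i)) = _
  rw [integral_map (Measurable.of_discrete).aemeasurable
    (measurable_one.indicator hs).aestronglyMeasurable,
    integral_fintype Integrable.of_finite, Finset.mul_sum,
    ← Fin.sum_univ_eq_sum_range (fun i => ((n + 1 : ℕ) : ℝ)⁻¹ * s.indicator (fun _ => (1 : ℝ)) (z i))]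
  refine Finset.sum_congr rfl fun i _ => ?_
  rw [measureReal_def, uniformOn_singleton_fin]
  simp only [smul_eq_mul]
  congr 1
  rw [ENNReal.toReal_inv]
  norm_cast

lemma emp_tendsto {Ω : Type*} [MeasurableSpace Ω] (P : Measure Ω) [IsProbabilityMeasure P]
    {𝒵 : Type*} [TopologicalSpace 𝒵] [SecondCountableTopology 𝒵] [MeasurableSpace 𝒵] [BorelSpace 𝒵]
    (Z : ℕ → Ω → 𝒵) (hZmeas : ∀ i, Measurable (Z i))
    (herg : Ergodic shift (P.map fun ω i => Z i ω))
    (θ : ProbabilityMeasure 𝒵) (hθ : (θ : Measure 𝒵) = P.map (Z 0)) :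
    ∀ᵐ ω ∂P, Tendsto (fun n => emp (fun i => Z i ω) n) atTop (𝓝 θ) := by
  obtain ⟨b, hbc, -, hb⟩ := TopologicalSpace.exists_countable_basis 𝒵
  have hSc : (generateSetAlgebra b).Countable := countable_generateSetAlgebra hbc
  have hSm : ∀ s ∈ generateSetAlgebra b, MeasurableSet s := fun s hs =>
    MeasurableSpace.generateFrom_le (fun t ht => (hb.isOpen ht).measurableSet) s
      (by rw [← generateFrom_generateSetAlgebra_eq]
          exact MeasurableSpace.measurableSet_generateFrom hs)
  have hpi : IsPiSystem (generateSetAlgebra b) := fun s hs t ht _ =>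
    isSetAlgebra_generateSetAlgebra.inter_mem hs ht
  have key : ∀ᵐ ω ∂P, ∀ s ∈ generateSetAlgebra b,
      Tendsto (fun n : ℕ => (n : ℝ)⁻¹ * ∑ i ∈ Finset.range n,
        s.indicator (fun _ => (1 : ℝ)) (Z i ω)) atTop
      (𝓝 (∫ z, s.indicator (fun _ => (1 : ℝ)) z ∂(θ : Measure 𝒵))) := by
    refine (ae_ball_iff hSc).2 fun s hs => ?_
    exact slln P Z hZmeas herg θ hθ _ ((integrable_const (1 : ℝ)).indicator (hSm s hs))
  filter_upwards [key] with ω hω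
  refine hpi.tendsto_probabilityMeasure_of_tendsto_of_mem hSm ?_ ?_
  · intro u hu x hx
    obtain ⟨v, hv, hxv, hvu⟩ := hb.exists_subset_of_mem_open hx hu
    exact ⟨v, self_subset_generateSetAlgebra hv, (hb.isOpen hv).mem_nhds hxv, hvu⟩
  · intro s hs
    rw [← NNReal.tendsto_coe]
    simp_rw [emp_apply _ _ (hSm s hs)]
    have h1 := (tendsto_add_atTop_iff_nat 1).2 (hω s hs)
    have h2 : ∫ z, s.indicator (fun _ => (1 : ℝ)) z ∂(θ : Measure 𝒵) = ((θ s : NNReal) : ℝ) :=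
      integral_indicator_one (hSm s hs)
    rwa [h2] at h1

end weak

/-- Truncation to `[-K, K]`. -/
def clampFn (K x : ℝ) : ℝ := max (-K) (min x K)

lemma clampFn_continuous (K : ℝ) : Continuous (clampFn K) := by
  unfold clampFn
  fun_prop

lemma clampFn_abs_le {K : ℝ} (hK : 0 ≤ K) (x : ℝ) : |clampFn K x| ≤ K := by
  unfold clampFn
  rw [abs_le]
  exact ⟨le_max_left _ _, max_le (by linarith) (min_le_right _ _)⟩

lemma abs_sub_clampFn_le {K : ℝ} (x F FL : ℝ) (hx : |x| ≤ F) (h1 : FL ≤ F)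
    (h2 : FL ≤ K) : |x - clampFn K x| ≤ F - FL := by
  unfold clampFn
  rw [abs_le] at hx ⊢
  rcases max_cases (-K) (min x K) with h | h <;> rcases min_cases x K with h' | h' <;>
    constructor <;> linarith

/-- The V-statistic. -/
def vstat {𝒵 : Type*} (z : ℕ → 𝒵) (d : ℕ) (g : (Fin d → 𝒵) → ℝ) (n : ℕ) : ℝ :=
  ((n : ℝ) ^ d)⁻¹ * ∑ i : Fin d → Fin n, g (fun j => z (i j))

lemma vstat_sub {𝒵 : Type*} (z : ℕ → 𝒵) (d : ℕ) (g g' : (Fin d → 𝒵) → ℝ) (n : ℕ) :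
    vstat z d (fun x => g x - g' x) n = vstat z d g n - vstat z d g' n := by
  simp [vstat, Finset.sum_sub_distrib, mul_sub]

lemma vstat_abs_le {𝒵 : Type*} (z : ℕ → 𝒵) (d : ℕ) (g g' : (Fin d → 𝒵) → ℝ) (n : ℕ)
    (h : ∀ x, |g x| ≤ g' x) : |vstat z d g n| ≤ vstat z d g' n := by
  unfold vstat
  rw [abs_mul, abs_of_nonneg (by positivity : (0 : ℝ) ≤ ((n : ℝ) ^ d)⁻¹)]
  gcongr
  exact (Finset.abs_sum_le_sum_abs _ _).trans (Finset.sum_le_sum fun i _ => h _)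

lemma vstat_prod {𝒵 : Type*} (z : ℕ → 𝒵) (d : ℕ) (g : 𝒵 → ℝ) (n : ℕ) :
    vstat z d (fun x => ∏ k, g (x k)) n = ((n : ℝ)⁻¹ * ∑ i ∈ Finset.range n, g (z i)) ^ d := by
  unfold vstat
  rw [mul_pow, inv_pow, ← Fin.sum_univ_eq_sum_range (fun i => g (z i)), Fintype.sum_pow]

lemma integral_prod_pow {𝒵 : Type*} [MeasurableSpace 𝒵] (θ : Measure 𝒵) [IsProbabilityMeasure θ]
    (d : ℕ) (g : 𝒵 → ℝ) :
    ∫ x, ∏ k, g (x k) ∂(Measure.pi fun _ : Fin d => θ) = (∫ z, g z ∂θ) ^ d := by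
  rw [integral_fintype_prod_eq_pow]
  simp

lemma vstat_det {𝒵 : Type*} [MeasurableSpace 𝒵] (θ : Measure 𝒵) [IsProbabilityMeasure θ]
    (z : ℕ → 𝒵) (d : ℕ) (h : (Fin d → 𝒵) → ℝ) (hm : Measurable h)
    (f : 𝒵 → ℝ) (hf : Integrable f θ) (hdom : ∀ z : Fin d → 𝒵, |h z| ≤ ∏ k, f (z k))
    (hc : ∀ K : ℝ, 0 ≤ K → Tendsto (vstat z d (fun x => clampFn K (h x))) atTop
      (𝓝 (∫ x, clampFn K (h x) ∂(Measure.pi fun _ : Fin d => θ))))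
    (h1 : Tendsto (fun n : ℕ => (n : ℝ)⁻¹ * ∑ i ∈ Finset.range n, |f (z i)|) atTop
      (𝓝 (∫ x, |f x| ∂θ)))
    (h2 : ∀ L : ℕ, Tendsto (fun n : ℕ => (n : ℝ)⁻¹ * ∑ i ∈ Finset.range n, min |f (z i)| L) atTop
      (𝓝 (∫ x, min |f x| L ∂θ))) :
    Tendsto (vstat z d h) atTop (𝓝 (∫ x, h x ∂(Measure.pi fun _ : Fin d => θ))) := by
  set π := Measure.pi fun _ : Fin d => θ with hπ
  have hdom' : ∀ x : Fin d → 𝒵, |h x| ≤ ∏ k, |f (x k)| := fun x => by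
    rw [← Finset.abs_prod]
    exact (hdom x).trans (le_abs_self _)
  have hFi : Integrable (fun x : Fin d → 𝒵 => ∏ k, |f (x k)|) π :=
    Integrable.fintype_prod (f := fun _ x => |f x|) fun _ => hf.abs
  have hmin : ∀ L : ℕ, Integrable (fun x => min |f x| (L : ℝ)) θ := fun L =>
    hf.abs.inf (integrable_const _)
  have hFLi : ∀ L : ℕ, Integrable (fun x : Fin d → 𝒵 => ∏ k, min |f (x k)| (L : ℝ)) π := fun L =>
    Integrable.fintype_prod (f := fun _ x => min |f x| (L : ℝ)) fun _ => hmin L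
  have hhi : Integrable h π := hFi.mono' hm.aestronglyMeasurable
    (Eventually.of_forall fun x => hdom' x)
  have hpt : ∀ (L : ℕ) (x : Fin d → 𝒵), |h x - clampFn ((L : ℝ) ^ d) (h x)| ≤
      ∏ k, |f (x k)| - ∏ k, min |f (x k)| (L : ℝ) := by
    intro L x
    have hnn : ∀ k, 0 ≤ min |f (x k)| (L : ℝ) := fun k => le_min (abs_nonneg _) (Nat.cast_nonneg _)
    refine abs_sub_clampFn_le _ _ _ (hdom' x) ?_ ?_
    · exact Finset.prod_le_prod (fun k _ => hnn k) fun k _ => min_le_left _ _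
    · calc ∏ k, min |f (x k)| (L : ℝ) ≤ ∏ _k : Fin d, (L : ℝ) :=
            Finset.prod_le_prod (fun k _ => hnn k) fun k _ => min_le_right _ _
        _ = (L : ℝ) ^ d := by simp
  -- truncation limit
  have hL : Tendsto (fun L : ℕ => ∫ x, min |f x| (L : ℝ) ∂θ) atTop (𝓝 (∫ x, |f x| ∂θ)) := by
    refine tendsto_integral_of_dominated_convergence (fun x => |f x|)
      (fun L => (hmin L).1) hf.abs ?_ ?_
    · intro L
      refine Eventually.of_forall fun x => ?_
      rw [Real.norm_eq_abs, abs_of_nonneg (le_min (abs_nonneg _) (Nat.cast_nonneg _))]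
      exact min_le_left _ _
    · refine Eventually.of_forall fun x => tendsto_const_nhds.congr' ?_
      filter_upwards [tendsto_natCast_atTop_atTop.eventually_ge_atTop |f x|] with L hL
      rw [min_eq_left hL]
  rw [Metric.tendsto_atTop']
  intro ε hε
  obtain ⟨L, hLe⟩ : ∃ L : ℕ, (∫ x, |f x| ∂θ) ^ d - (∫ x, min |f x| (L : ℝ) ∂θ) ^ d < ε / 4 := by
    have : Tendsto (fun L : ℕ => (∫ x, |f x| ∂θ) ^ d - (∫ x, min |f x| (L : ℝ) ∂θ) ^ d) atTop
        (𝓝 ((∫ x, |f x| ∂θ) ^ d - (∫ x, |f x| ∂θ) ^ d)) := tendsto_const_nhds.sub (hL.pow d)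
    rw [sub_self] at this
    exact (this.eventually_lt_const (by linarith)).exists
  set K := (L : ℝ) ^ d with hK
  have hK0 : 0 ≤ K := by positivity
  have e1 := (Metric.tendsto_nhds.1 (hc K hK0)) (ε / 4) (by linarith)
  have e2 := ((h1.pow d).sub ((h2 L).pow d)).eventually_lt_const hLe
  have hci : Integrable (fun x => clampFn K (h x)) π :=
    (integrable_const K).mono' ((clampFn_continuous K).measurable.comp hm).aestronglyMeasurable
      (Eventually.of_forall fun x => clampFn_abs_le hK0 _)
  have e3 : |∫ x, h x ∂π - ∫ x, clampFn K (h x) ∂π| < ε / 4 := by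
    rw [← integral_sub hhi hci, ← Real.norm_eq_abs]
    have hsub : Integrable (fun x : Fin d → 𝒵 =>
        ∏ k, |f (x k)| - ∏ k, min |f (x k)| (L : ℝ)) π := hFi.sub (hFLi L)
    calc ‖∫ x, (h x - clampFn K (h x)) ∂π‖
        ≤ ∫ x, (∏ k, |f (x k)| - ∏ k, min |f (x k)| (L : ℝ)) ∂π :=
          norm_integral_le_of_norm_le (f := fun x => h x - clampFn K (h x)) hsub (Eventually.of_forall fun x => hpt L x)
      _ < ε / 4 := by
          rw [integral_sub hFi (hFLi L), hπ, integral_prod_pow θ d (fun x => |f x|),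
            integral_prod_pow θ d (fun x => min |f x| (L : ℝ))]
          exact hLe
  obtain ⟨N, hN⟩ := eventually_atTop.1 (e1.and e2)
  refine ⟨N, fun n hn => ?_⟩
  obtain ⟨a1, a2⟩ := hN n hn.le
  have a3 : |vstat z d h n - vstat z d (fun x => clampFn K (h x)) n| < ε / 4 := by
    rw [← vstat_sub]
    refine (vstat_abs_le z d _ _ n (hpt L)).trans_lt ?_
    rw [vstat_sub z d (fun x => ∏ k, |f (x k)|) (fun x => ∏ k, min |f (x k)| (L : ℝ)),
      vstat_prod z d (fun x => |f x|), vstat_prod z d (fun x => min |f x| (L : ℝ))]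
    exact a2
  rw [Real.dist_eq] at a1 ⊢
  rw [abs_lt] at *
  constructor <;> linarith [a1.1, a1.2, a3.1, a3.2, e3.1, e3.2]


/-- If `(Z_k)` is a strictly stationary ergodic process with values in a
separable metrizable topological space `𝒵` and marginal distribution `θ`, and
`h : 𝒵^d → ℝ` is measurable, `θ^d`-a.e. continuous and dominated by a product
`∏ f(z_k)` with `f` `θ`-integrable, then the V-statistic `V_h(Z₁,…,Zₙ)` converges almost
surely to `∫ h dθ^d`. -/
theorem vstatistic_ergodic_strong_law
    {Ω : Type*} [MeasurableSpace Ω] (P : Measure Ω) [IsProbabilityMeasure P]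
    {𝒵 : Type*} [TopologicalSpace 𝒵] [TopologicalSpace.MetrizableSpace 𝒵]
    [TopologicalSpace.SeparableSpace 𝒵] [MeasurableSpace 𝒵] [BorelSpace 𝒵]
    (Z : ℕ → Ω → 𝒵) (hZmeas : ∀ i, Measurable (Z i))
    -- strict stationarity: the law of the path is shift-invariant
    (hstat : MeasurePreserving shift (P.map fun ω i => Z i ω) (P.map fun ω i => Z i ω))
    -- ergodicity of the process
    (herg : Ergodic shift (P.map fun ω i => Z i ω))
    (θ : Measure 𝒵) (hθ : θ = P.map (Z 0))
    (d : ℕ) (h : (Fin d → 𝒵) → ℝ) (hmeas : Measurable h)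
    (hcont : ∀ᵐ z ∂(Measure.pi fun _ : Fin d => θ), ContinuousAt h z)
    (f : 𝒵 → ℝ) (hf : Integrable f θ)
    (hdom : ∀ z : Fin d → 𝒵, |h z| ≤ ∏ k, f (z k)) :
    ∀ᵐ ω ∂P, Tendsto
      (fun n : ℕ => ((n : ℝ) ^ d)⁻¹ * ∑ i : Fin d → Fin n, h (fun j => Z (i j) ω))
      atTop (𝓝 (∫ z, h z ∂(Measure.pi fun _ : Fin d => θ))) := by
  letI : MetricSpace 𝒵 := TopologicalSpace.metrizableSpaceMetric 𝒵
  haveI : SecondCountableTopology 𝒵 := UniformSpace.secondCountable_of_separable 𝒵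
  have hθp : IsProbabilityMeasure θ := by
    rw [hθ]
    exact Measure.isProbabilityMeasure_map (hZmeas 0).aemeasurable
  let Θ : ProbabilityMeasure 𝒵 := ⟨θ, hθp⟩
  have w1 := emp_tendsto P Z hZmeas herg Θ hθ
  have w2 := slln P Z hZmeas herg θ hθ (fun x => |f x|) hf.abs
  have w3 : ∀ᵐ ω ∂P, ∀ L : ℕ, Tendsto
      (fun n : ℕ => (n : ℝ)⁻¹ * ∑ i ∈ Finset.range n, min |f (Z i ω)| (L : ℝ)) atTop
      (𝓝 (∫ x, min |f x| (L : ℝ) ∂θ)) :=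
    ae_all_iff.2 fun L => slln P Z hZmeas herg θ hθ (fun x => min |f x| (L : ℝ))
      (hf.abs.inf (integrable_const _))
  filter_upwards [w1, w2, w3] with ω h1 h2 h3
  refine vstat_det θ (fun i => Z i ω) d h hmeas f hf hdom (fun K hK => ?_) h2 h3
  rw [← tendsto_add_atTop_iff_nat 1]
  have hpi : Tendsto (fun n => ProbabilityMeasure.pi
      (fun _ : Fin d => emp (fun i => Z i ω) n)) atTop
      (𝓝 (ProbabilityMeasure.pi fun _ : Fin d => Θ)) :=
    (ProbabilityMeasure.continuous_pi.tendsto (fun _ : Fin d => Θ)).comp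
      (tendsto_pi_nhds.2 fun _ => h1)
  have hmap := map_tendsto hpi hmeas hcont
  have hbc := (ProbabilityMeasure.tendsto_iff_forall_integral_tendsto.1 hmap)
    (BoundedContinuousFunction.ofNormedAddCommGroup (clampFn K) (clampFn_continuous K) K
      (fun x => clampFn_abs_le hK x))
  have hcm : Measurable (clampFn K) := (clampFn_continuous K).measurable
  have eI : ∀ ν : ProbabilityMeasure (Fin d → 𝒵),
      ∫ x, clampFn K x ∂((ν.map hmeas.aemeasurable : ProbabilityMeasure ℝ) : Measure ℝ)
        = ∫ x, clampFn K (h x) ∂(ν : Measure (Fin d → 𝒵)) := by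
    intro ν
    exact integral_map hmeas.aemeasurable hcm.aestronglyMeasurable
  simp only [BoundedContinuousFunction.coe_ofNormedAddCommGroup, eI,
    ProbabilityMeasure.toMeasure_pi] at hbc
  refine hbc.congr fun n => ?_
  exact integral_emp_pi (fun i => Z i ω) n d (fun x => clampFn K (h x)) (hcm.comp hmeas)
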